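/- Let b₀, …, bₙ : ℤ → Matrix (Fin r) (Fin r) R, and let φ : ℤ → Matrix (Fin r) (Fin m) R and ψ : ℤ → Matrix (Fin m) (Fin r) R both have support bounded below. Let 𝕋 = Σ_{i=0}^{n} M_{b_i}∘Δ^i + M_φ∘J∘M_ψ acting on V_r. For p ∈ ℕ and matrix sequences F : ℤ → Matrix (Fin r) (Fin p) R with support bounded below define 𝕃·F := Σ_{i=0}^{n} b_i·Δ^i(F) + φ·J(ψ·F), and for G : ℤ → Matrix (Fin p) (Fin r) R with support bounded below define 𝕃*·G := Σ_{i=0}^{n} (-1)^i Δ^i(Λ⁻ⁱ(G·b_i)) - Λ(J(G·φ))·ψ. Then for every k ≥ 1 there exist N ∈ ℕ and c₀, …, c_N : ℤ → Matrix (Fin r) (Fin r) R such that, as operators on V_r, 𝕋^k = Σ_{i=0}^{N} M_{c_i}∘Δ^i + Σ_{j=0}^{k-1} M_{𝕃^{k-1-j}·φ}∘J∘M_{(𝕃*)^j·ψ}. (This is the lemma (𝕃_Δ^k)₋ = Σ_{j=0}^{k-1} 𝕃_Δ^{k-j-1}(φ) Δ⁻¹ (𝕃_Δ*)^j(ψ)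 for the discrete constrained multi-component KP Lax operator.) -/

import Mathlib

open Finset

/-- A sequence with values in `A` has support bounded below. -/
def SuppBddBelow {A : Type*} [Zero A] (f : ℤ → A) : Prop :=
  ∃ M : ℤ, ∀ n : ℤ, n < M → f n = 0

/-- The shift operator `(Λ f)(n) = f(n+1)` (applied entrywise). -/
def shiftL {A : Type*} (f : ℤ → A) : ℤ → A := fun n => f (n + 1)

/-- The inverse shift operator `(Λ⁻¹ f)(n) = f(n-1)` (applied entrywise). -/
def shiftLinv {A : Type*} (f : ℤ → A) : ℤ → A := fun n => f (n - 1)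

/-- The difference operator `(Δ f)(n) = f(n+1) - f(n)` (applied entrywise). -/
def Del {A : Type*} [AddCommGroup A] (f : ℤ → A) : ℤ → A := fun n => f (n + 1) - f n

/-- The summation operator `(J f)(n) = ∑_{m < n} f(m)` (a finite sum when the
support of `f` is bounded below, realized via `finsum`; applied entrywise). -/
noncomputable def Jop {A : Type*} [AddCommMonoid A] (f : ℤ → A) : ℤ → A :=
  fun n => ∑ᶠ (m : ℤ) (_ : m < n), f m

variable {R : Type*} [CommRing R]

/-- The operator `𝕋 = Σ_{i=0}^{n} M_{b_i}∘Δⁱ + M_φ∘J∘M_ψ` acting on `V_r`. -/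
noncomputable def TTop {r m : ℕ} (n : ℕ) (b : ℕ → ℤ → Matrix (Fin r) (Fin r) R)
    (φ : ℤ → Matrix (Fin r) (Fin m) R) (ψ : ℤ → Matrix (Fin m) (Fin r) R)
    (g : ℤ → Fin r → R) : ℤ → Fin r → R :=
  fun k => (∑ i ∈ Finset.range (n + 1), (b i k).mulVec (Del^[i] g k))
    + (φ k).mulVec (Jop (fun j => (ψ j).mulVec (g j)) k)

/-- The action `𝕃·F = Σ_{i=0}^{n} b_i·Δⁱ(F) + φ·J(ψ·F)` on matrix-valued sequences. -/
noncomputable def LLMat {r m p : ℕ} (n : ℕ) (b : ℕ → ℤ → Matrix (Fin r) (Fin r) R)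
    (φ : ℤ → Matrix (Fin r) (Fin m) R) (ψ : ℤ → Matrix (Fin m) (Fin r) R)
    (F : ℤ → Matrix (Fin r) (Fin p) R) : ℤ → Matrix (Fin r) (Fin p) R :=
  fun k => (∑ i ∈ Finset.range (n + 1), b i k * Del^[i] F k)
    + φ k * Jop (fun j => ψ j * F j) k

/-- The adjoint action `𝕃*·G = Σ_{i=0}^{n} (-1)ⁱ Δⁱ(Λ⁻ⁱ(G·b_i)) - Λ(J(G·φ))·ψ`. -/
noncomputable def LLStarMat {r m p : ℕ} (n : ℕ) (b : ℕ → ℤ → Matrix (Fin r) (Fin r) R)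
    (φ : ℤ → Matrix (Fin r) (Fin m) R) (ψ : ℤ → Matrix (Fin m) (Fin r) R)
    (G : ℤ → Matrix (Fin p) (Fin r) R) : ℤ → Matrix (Fin p) (Fin r) R :=
  fun k => (∑ i ∈ Finset.range (n + 1),
      ((-1 : R) ^ i) • Del^[i] (shiftLinv^[i] (fun j => G j * b i j)) k)
    - shiftL (Jop (fun j => G j * φ j)) k * ψ k

namespace SuppBddBelow

variable {A B C : Type*}

theorem map [Zero A] [Zero B] {f : ℤ → A} (hf : SuppBddBelow f) (L : ℤ → A → B)
    (hL : ∀ x, L x 0 = 0) : SuppBddBelow fun x => L x (f x) := by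
  obtain ⟨M, hM⟩ := hf
  exact ⟨M, fun x hx => by simp only [hM x hx, hL]⟩

theorem map₂ [Zero A] [Zero B] [Zero C] {f : ℤ → A} {g : ℤ → B} (hf : SuppBddBelow f)
    (hg : SuppBddBelow g) (L : A → B → C) (hL : L 0 0 = 0) :
    SuppBddBelow fun x => L (f x) (g x) := by
  obtain ⟨M, hM⟩ := hf
  obtain ⟨M', hM'⟩ := hg
  refine ⟨min M M', fun x hx => ?_⟩
  rw [lt_min_iff] at hx
  simp only [hM x hx.1, hM' x hx.2, hL]

theorem add [AddZeroClass A] {f g : ℤ → A} (hf : SuppBddBelow f) (hg : SuppBddBelow g) :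
    SuppBddBelow fun x => f x + g x :=
  hf.map₂ hg (· + ·) (add_zero 0)

theorem sub [AddGroup A] {f g : ℤ → A} (hf : SuppBddBelow f) (hg : SuppBddBelow g) :
    SuppBddBelow fun x => f x - g x :=
  hf.map₂ hg (· - ·) (sub_zero 0)

theorem sum [AddCommMonoid A] {ι : Type*} (s : Finset ι) {f : ι → ℤ → A}
    (hf : ∀ i ∈ s, SuppBddBelow (f i)) : SuppBddBelow fun x => ∑ i ∈ s, f i x := by
  classical
  induction s using Finset.induction_on with
  | empty => exact ⟨0, fun _ _ => Finset.sum_empty⟩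
  | insert i s hi ih =>
    simp only [Finset.sum_insert hi]
    exact (hf i (Finset.mem_insert_self i s)).add
      (ih fun j hj => hf j (Finset.mem_insert_of_mem hj))

theorem comp_add [Zero A] {f : ℤ → A} (hf : SuppBddBelow f) (a : ℤ) :
    SuppBddBelow fun x => f (x + a) := by
  obtain ⟨M, hM⟩ := hf
  exact ⟨M - a, fun x hx => hM _ (by omega)⟩

theorem Del [AddCommGroup A] {f : ℤ → A} (hf : SuppBddBelow f) : SuppBddBelow (Del f) :=
  (hf.comp_add 1).sub hf

theorem Del_iterate [AddCommGroup A] {f : ℤ → A} (hf : SuppBddBelow f) (i : ℕ) :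
    SuppBddBelow (_root_.Del^[i] f) := by
  induction i with
  | zero => exact hf
  | succ i ih =>
    rw [Function.iterate_succ_apply']
    exact ih.Del

theorem Jop [AddCommMonoid A] {f : ℤ → A} (hf : SuppBddBelow f) : SuppBddBelow (Jop f) := by
  obtain ⟨M, hM⟩ := hf
  refine ⟨M, fun x hx => ?_⟩
  refine finsum_mem_eq_zero_of_forall_eq_zero fun y hy => hM y ?_
  exact lt_trans hy hx

theorem mulVec {p q : ℕ} (u : ℤ → Matrix (Fin p) (Fin q) R) {g : ℤ → Fin q → R}
    (hg : SuppBddBelow g) : SuppBddBelow fun x => (u x).mulVec (g x) :=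
  hg.map (fun x => (u x).mulVec) fun _ => Matrix.mulVec_zero _

theorem mulVec_left {p q : ℕ} {u : ℤ → Matrix (Fin p) (Fin q) R} (hu : SuppBddBelow u)
    (g : ℤ → Fin q → R) : SuppBddBelow fun x => (u x).mulVec (g x) :=
  hu.map (fun x M => M.mulVec (g x)) fun _ => Matrix.zero_mulVec _

theorem TTop {r m n : ℕ} (b : ℕ → ℤ → Matrix (Fin r) (Fin r) R)
    {φ : ℤ → Matrix (Fin r) (Fin m) R} (ψ : ℤ → Matrix (Fin m) (Fin r) R)
    (hφ : SuppBddBelow φ) {g : ℤ → Fin r → R} (hg : SuppBddBelow g) :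
    SuppBddBelow (TTop n b φ ψ g) :=
  (SuppBddBelow.sum _ fun i _ => (hg.Del_iterate i).mulVec (b i)).add (hφ.mulVec_left _)

end SuppBddBelow

section Summation

variable {A B : Type*} [AddCommGroup A] [AddCommGroup B]

theorem Del_Jop {f : ℤ → A} (hf : SuppBddBelow f) : Del (Jop f) = f := by
  obtain ⟨M, hM⟩ := hf
  funext x
  have hfin : (Set.Iio x ∩ Function.support f).Finite := by
    refine (Set.finite_Ico M x).subset fun y hy => ⟨?_, hy.1⟩
    by_contra! h
    exact hy.2 (hM y h)
  have hset : {y : ℤ | y < x + 1} = insert x (Set.Iio x) := by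
    ext y
    simp only [Set.mem_ofPred_eq, Set.mem_insert_iff, Set.mem_Iio]
    omega
  have hsucc : Jop f (x + 1) = f x + Jop f x := by
    change ∑ᶠ (y : ℤ) (_ : y ∈ {y : ℤ | y < x + 1}), f y = _
    rw [hset, finsum_mem_insert' f (by simp) hfin]
    rfl
  rw [Del, hsucc, add_sub_cancel_right]

theorem eq_zero_of_Del_eq_zero {f : ℤ → A} (hf : SuppBddBelow f) (h : Del f = 0) : f = 0 := by
  obtain ⟨M, hM⟩ := hf
  have hstep : ∀ x, f (x + 1) = f x := fun x => sub_eq_zero.mp (congrFun h x)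
  funext x
  rcases lt_or_ge x M with hx | hx
  · exact hM x hx
  · induction x, hx using Int.leInduction with
    | base =>
      have := hstep (M - 1)
      rw [sub_add_cancel] at this
      rw [this]
      exact hM _ (by omega)
    | succ x _ ih => exact (hstep x).trans ih

theorem Jop_eq_of_Del_eq {f F : ℤ → A} (hF : SuppBddBelow F) (h : ∀ x, Del F x = f x) :
    Jop f = F := by
  obtain rfl : Del F = f := funext h
  have key : (fun x => Jop (Del F) x - F x) = 0 := by
    refine eq_zero_of_Del_eq_zero (hF.Del.Jop.sub hF) (funext fun x => ?_)
    have := congrFun (Del_Jop hF.Del) x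
    simp only [Del, Pi.zero_apply] at this ⊢
    rw [sub_sub_sub_comm, this, sub_self]
  exact funext fun x => sub_eq_zero.mp (congrFun key x)

theorem Del_add (f g : ℤ → A) : Del (fun x => f x + g x) = fun x => Del f x + Del g x :=
  funext fun _ => add_sub_add_comm _ _ _ _

theorem Del_iterate_add (i : ℕ) (f g : ℤ → A) :
    Del^[i] (fun x => f x + g x) = fun x => Del^[i] f x + Del^[i] g x := by
  induction i generalizing f g with
  | zero => rfl
  | succ i ih => rw [Function.iterate_succ_apply, Del_add, ih]; rfl

theorem Del_iterate_map (L : A →+ B) (i : ℕ) (f : ℤ → A) :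
    Del^[i] (fun x => L (f x)) = fun x => L (Del^[i] f x) := by
  induction i generalizing f with
  | zero => rfl
  | succ i ih =>
    have : Del (fun x => L (f x)) = fun x => L (Del f x) :=
      funext fun _ => (map_sub L _ _).symm
    rw [Function.iterate_succ_apply, this, ih]
    rfl

theorem shiftLinv_iterate_map (L : A →+ B) (i : ℕ) (f : ℤ → A) :
    shiftLinv^[i] (fun x => L (f x)) = fun x => L (shiftLinv^[i] f x) := by
  induction i generalizing f with
  | zero => rfl
  | succ i ih => exact ih (shiftLinv f)

theorem Jop_map (L : A →+ B) {f : ℤ → A} (hf : SuppBddBelow f) :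
    Jop (fun x => L (f x)) = fun x => L (Jop f x) := by
  refine Jop_eq_of_Del_eq (hf.Jop.map (fun _ => L) fun _ => map_zero L) fun x => ?_
  rw [Del, ← map_sub]
  exact congrArg L (congrFun (Del_Jop hf) x)

theorem Jop_add {f g : ℤ → A} (hf : SuppBddBelow f) (hg : SuppBddBelow g) :
    Jop (fun x => f x + g x) = fun x => Jop f x + Jop g x :=
  Jop_eq_of_Del_eq (hf.Jop.add hg.Jop) fun x => by rw [Del_add, Del_Jop hf, Del_Jop hg]

theorem Jop_sub {f g : ℤ → A} (hf : SuppBddBelow f) (hg : SuppBddBelow g) :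
    Jop (fun x => f x - g x) = fun x => Jop f x - Jop g x := by
  refine Jop_eq_of_Del_eq (hf.Jop.sub hg.Jop) fun x => ?_
  rw [← congrFun (Del_Jop hf) x, ← congrFun (Del_Jop hg) x]
  exact sub_sub_sub_comm _ _ _ _

theorem Jop_sum {ι : Type*} (s : Finset ι) {f : ι → ℤ → A}
    (hf : ∀ i ∈ s, SuppBddBelow (f i)) :
    Jop (fun x => ∑ i ∈ s, f i x) = fun x => ∑ i ∈ s, Jop (f i) x := by
  refine Jop_eq_of_Del_eq (SuppBddBelow.sum s fun i hi => (hf i hi).Jop) fun x => ?_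
  rw [Del, ← Finset.sum_sub_distrib]
  exact Finset.sum_congr rfl fun i hi => congrFun (Del_Jop (hf i hi)) x

theorem Del_shiftLinv_comm : Function.Commute (Del (A := A)) shiftLinv := fun f => by
  funext x
  simp only [Del, shiftLinv]
  congr 2
  omega

end Summation

section MulVec

variable {p q : ℕ}

theorem Del_mulVec (u : ℤ → Matrix (Fin p) (Fin q) R) (v : ℤ → Fin q → R) (x : ℤ) :
    Del (fun y => (u y).mulVec (v y)) x
      = (Del u x).mulVec (v x) + (shiftL u x).mulVec (Del v x) := by
  simp only [Del, shiftL, Matrix.sub_mulVec, Matrix.mulVec_sub]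
  abel

theorem Jop_mulVec_Del (u : ℤ → Matrix (Fin p) (Fin q) R) {v : ℤ → Fin q → R}
    (hv : SuppBddBelow v) :
    Jop (fun y => (u y).mulVec (Del v y))
      = fun x => (shiftLinv u x).mulVec (v x)
          - Jop (fun y => (Del (shiftLinv u) y).mulVec (v y)) x := by
  have hJ := hv.mulVec (Del (shiftLinv u))
  refine Jop_eq_of_Del_eq ((hv.mulVec (shiftLinv u)).sub hJ.Jop) fun x => ?_
  have h₁ := Del_mulVec (shiftLinv u) v x
  have h₂ := congrFun (Del_Jop hJ) x
  have h₃ : shiftL (shiftLinv u) x = u x := by simp [shiftL, shiftLinv]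
  rw [h₃] at h₁
  rw [← add_sub_cancel_left ((Del (shiftLinv u) x).mulVec (v x)) ((u x).mulVec _), ← h₁, ← h₂]
  exact sub_sub_sub_comm _ _ _ _

theorem Jop_mulVec_Jop {u : ℤ → Matrix (Fin p) (Fin q) R} (hu : SuppBddBelow u)
    {w : ℤ → Fin q → R} (hw : SuppBddBelow w) :
    Jop (fun y => (u y).mulVec (Jop w y))
      = fun x => (Jop u x).mulVec (Jop w x)
          - Jop (fun y => (shiftL (Jop u) y).mulVec (w y)) x := by
  have hJ := hw.mulVec (shiftL (Jop u))
  refine Jop_eq_of_Del_eq ((hw.Jop.mulVec (Jop u)).sub hJ.Jop) fun x => ?_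
  have h₁ := Del_mulVec (Jop u) (Jop w) x
  have h₂ := congrFun (Del_Jop hJ) x
  rw [Del_Jop hu, Del_Jop hw] at h₁
  rw [← add_sub_cancel_right ((u x).mulVec (Jop w x)) ((shiftL (Jop u) x).mulVec (w x)), ← h₁,
    ← h₂]
  exact sub_sub_sub_comm _ _ _ _

/-- The additive map `M ↦ M v`. -/
def mulVecHom (v : Fin q → R) : Matrix (Fin p) (Fin q) R →+ (Fin p → R) where
  toFun M := M.mulVec v
  map_zero' := Matrix.zero_mulVec v
  map_add' M N := Matrix.add_mulVec M N v

end MulVec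

/-- The local difference operators `Σ M_{c_i}∘Δⁱ`, as an additive submonoid of all operators. -/
def localOps (R : Type*) [CommRing R] (p r : ℕ) :
    AddSubmonoid ((ℤ → Fin r → R) → ℤ → Fin p → R) :=
  AddSubmonoid.closure {P | ∃ (c : ℤ → Matrix (Fin p) (Fin r) R) (i : ℕ),
    P = fun g x => (c x).mulVec (Del^[i] g x)}

section LocalOps

variable {p q r m n : ℕ}

theorem mulVec_Del_iterate_mem_localOps (c : ℤ → Matrix (Fin p) (Fin r) R) (i : ℕ) :
    (fun g x => (c x).mulVec (Del^[i] g x)) ∈ localOps R p r :=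
  AddSubmonoid.subset_closure ⟨c, i, rfl⟩

theorem mulVec_comp_mem_localOps (a : ℤ → Matrix (Fin q) (Fin p) R)
    {P : (ℤ → Fin r → R) → ℤ → Fin p → R} (hP : P ∈ localOps R p r) :
    (fun g x => (a x).mulVec (P g x)) ∈ localOps R q r := by
  induction hP using AddSubmonoid.closure_induction with
  | mem P h =>
    obtain ⟨c, i, rfl⟩ := h
    simp only [Matrix.mulVec_mulVec]
    exact mulVec_Del_iterate_mem_localOps (fun x => a x * c x) i
  | zero =>
    simp only [Pi.zero_apply, Matrix.mulVec_zero]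
    exact zero_mem _
  | add P Q _ _ hP hQ =>
    simp only [Pi.add_apply, Matrix.mulVec_add]
    exact add_mem hP hQ

theorem Del_comp_mem_localOps {P : (ℤ → Fin r → R) → ℤ → Fin p → R}
    (hP : P ∈ localOps R p r) : (fun g => Del (P g)) ∈ localOps R p r := by
  induction hP using AddSubmonoid.closure_induction with
  | mem P h =>
    obtain ⟨c, i, rfl⟩ := h
    have h : (fun g : ℤ → Fin r → R => Del fun x => (c x).mulVec (Del^[i] g x))
        = (fun g x => (Del c x).mulVec (Del^[i] g x))
          + fun g x => (shiftL c x).mulVec (Del^[i + 1] g x) := by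
      funext g x
      rw [Del_mulVec, ← Function.iterate_succ_apply' Del]
      rfl
    rw [h]
    exact add_mem (mulVec_Del_iterate_mem_localOps _ _) (mulVec_Del_iterate_mem_localOps _ _)
  | zero =>
    convert zero_mem (localOps R p r) using 1
    funext g x
    exact sub_self 0
  | add P Q _ _ hP hQ =>
    convert add_mem hP hQ using 1
    funext g
    exact Del_add _ _

theorem Del_iterate_comp_mem_localOps (i : ℕ) {P : (ℤ → Fin r → R) → ℤ → Fin p → R}
    (hP : P ∈ localOps R p r) : (fun g => Del^[i] (P g)) ∈ localOps R p r := by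
  induction i with
  | zero => exact hP
  | succ i ih =>
    simp only [Function.iterate_succ_apply']
    exact Del_comp_mem_localOps ih

theorem sum_mem_localOps {ι : Type*} (s : Finset ι)
    {P : ι → (ℤ → Fin r → R) → ℤ → Fin p → R} (hP : ∀ i ∈ s, P i ∈ localOps R p r) :
    (fun g x => ∑ i ∈ s, P i g x) ∈ localOps R p r := by
  convert sum_mem hP using 1
  funext g x
  simp only [Finset.sum_apply]

theorem sum_range_mulVec_Del_extend (c : ℕ → ℤ → Matrix (Fin p) (Fin r) R) {N K : ℕ}
    (h : N ≤ K) (g : ℤ → Fin r → R) (x : ℤ) :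
    ∑ i ∈ Finset.range N, (c i x).mulVec (Del^[i] g x)
      = ∑ i ∈ Finset.range K, (if i < N then c i x else 0).mulVec (Del^[i] g x) := by
  rw [← Finset.sum_subset (Finset.range_mono h)]
  · exact Finset.sum_congr rfl fun i hi => by rw [if_pos (Finset.mem_range.mp hi)]
  · intro i _ hi
    rw [if_neg (by simpa using hi), Matrix.zero_mulVec]

theorem exists_sum_of_mem_localOps {P : (ℤ → Fin r → R) → ℤ → Fin p → R}
    (hP : P ∈ localOps R p r) :
    ∃ (N : ℕ) (c : ℕ → ℤ → Matrix (Fin p) (Fin r) R), ∀ g x,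
      P g x = ∑ i ∈ Finset.range (N + 1), (c i x).mulVec (Del^[i] g x) := by
  induction hP using AddSubmonoid.closure_induction with
  | mem P h =>
    obtain ⟨c, i, rfl⟩ := h
    refine ⟨i, fun j => if j = i then c else 0, fun g x => ?_⟩
    rw [Finset.sum_eq_single i]
    · simp only [if_true]
    · intro j _ hj
      simp only [if_neg hj, Pi.zero_apply, Matrix.zero_mulVec]
    · simp
  | zero => exact ⟨0, 0, fun g x => by simp⟩
  | add P Q _ _ hP hQ =>
    obtain ⟨N, c, hc⟩ := hP
    obtain ⟨K, d, hd⟩ := hQ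
    refine ⟨max N K, fun i x => (if i < N + 1 then c i x else 0)
      + if i < K + 1 then d i x else 0, fun g x => ?_⟩
    simp only [Matrix.add_mulVec, Finset.sum_add_distrib]
    rw [Pi.add_apply, Pi.add_apply, hc, hd,
      sum_range_mulVec_Del_extend c (by omega : N + 1 ≤ max N K + 1),
      sum_range_mulVec_Del_extend d (by omega : K + 1 ≤ max N K + 1)]

/-- `Δⁱ∘M_f∘J∘M_ψ = M_{Δⁱf}∘J∘M_ψ` up to a local operator. -/
theorem exists_Del_iterate_mulVec_Jop (f : ℤ → Matrix (Fin p) (Fin m) R)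
    (ψ : ℤ → Matrix (Fin m) (Fin r) R) (i : ℕ) :
    ∃ P ∈ localOps R p r, ∀ g, SuppBddBelow g →
      Del^[i] (fun y => (f y).mulVec (Jop (fun z => (ψ z).mulVec (g z)) y))
        = fun x => (Del^[i] f x).mulVec (Jop (fun z => (ψ z).mulVec (g z)) x) + P g x := by
  induction i with
  | zero => exact ⟨0, zero_mem _, fun g _ => by simp⟩
  | succ i ih =>
    obtain ⟨P, hP, h⟩ := ih
    refine ⟨_, add_mem (mulVec_comp_mem_localOps (shiftL (Del^[i] f))
      (mulVec_Del_iterate_mem_localOps ψ 0)) (Del_comp_mem_localOps hP), fun g hg => ?_⟩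
    rw [Function.iterate_succ_apply', h g hg, Del_add]
    funext x
    rw [Del_mulVec, Del_Jop (hg.mulVec ψ), Function.iterate_succ_apply', add_assoc]
    rfl

/-- `J∘M_u∘Δⁱ = (-1)ⁱ J∘M_{ΔⁱΛ⁻ⁱu}` up to a local operator. -/
theorem exists_Jop_mulVec_Del_iterate (u : ℤ → Matrix (Fin p) (Fin r) R) (i : ℕ) :
    ∃ P ∈ localOps R p r, ∀ g, SuppBddBelow g → ∀ x,
      Jop (fun y => (u y).mulVec (Del^[i] g y)) x
        = P g x + Jop (fun y => ((-1 : R) ^ i • Del^[i] (shiftLinv^[i] u) y).mulVec (g y)) x := by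
  induction i generalizing u with
  | zero => exact ⟨0, zero_mem _, fun g _ x => by simp⟩
  | succ i ih =>
    obtain ⟨P, hP, h⟩ := ih fun y => -Del (shiftLinv u) y
    refine ⟨_, add_mem (mulVec_Del_iterate_mem_localOps (shiftLinv u) i) hP, fun g hg x => ?_⟩
    have hneg : ∀ y, (-1 : R) ^ i • Del^[i] (shiftLinv^[i] fun y => -Del (shiftLinv u) y) y
        = (-1 : R) ^ (i + 1) • Del^[i + 1] (shiftLinv^[i + 1] u) y := fun y => by
      have h₁ := shiftLinv_iterate_map (-AddMonoidHom.id _) i (Del (shiftLinv u))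
      have h₂ := congrFun (Del_iterate_map (-AddMonoidHom.id _) i
        (shiftLinv^[i] (Del (shiftLinv u)))) y
      simp only [AddMonoidHom.neg_apply, AddMonoidHom.id_apply] at h₁ h₂
      rw [h₁, h₂, Function.iterate_succ_apply, Function.iterate_succ_apply,
        (Del_shiftLinv_comm.iterate_right i) (shiftLinv u), pow_succ, mul_neg_one, smul_neg,
        neg_smul]
    have hstep := congrFun (Jop_mulVec_Del u (hg.Del_iterate i)) x
    have hJneg := congrFun (Jop_map (-AddMonoidHom.id _)
      ((hg.Del_iterate i).mulVec (Del (shiftLinv u)))) x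
    have hx := h g hg x
    simp only [hneg] at hx
    simp only [AddMonoidHom.neg_apply, AddMonoidHom.id_apply, ← Matrix.neg_mulVec] at hJneg
    simp only [Function.iterate_succ_apply' Del i g]
    rw [hstep, sub_eq_add_neg, ← hJneg, hx, ← add_assoc]
    rfl

/-- `J∘M_G∘𝕋 = J∘M_{𝕃*·G} + M_{J(G·φ)}∘J∘M_ψ` up to a local operator. -/
theorem exists_Jop_mulVec_TTop (b : ℕ → ℤ → Matrix (Fin r) (Fin r) R)
    {φ : ℤ → Matrix (Fin r) (Fin m) R} (ψ : ℤ → Matrix (Fin m) (Fin r) R)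
    (hφ : SuppBddBelow φ) (G : ℤ → Matrix (Fin p) (Fin r) R) :
    ∃ P ∈ localOps R p r, ∀ g, SuppBddBelow g → ∀ x,
      Jop (fun y => (G y).mulVec (TTop n b φ ψ g y)) x
        = P g x + Jop (fun y => (LLStarMat n b φ ψ G y).mulVec (g y)) x
          + (Jop (fun y => G y * φ y) x).mulVec (Jop (fun y => (ψ y).mulVec (g y)) x) := by
  choose P hP h using fun i => exists_Jop_mulVec_Del_iterate (fun y => G y * b i y) i
  refine ⟨_, sum_mem_localOps (Finset.range (n + 1)) fun i _ => hP i, fun g hg x => ?_⟩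
  have hGφ : SuppBddBelow fun y => G y * φ y :=
    hφ.map (fun y M => G y * M) fun _ => Matrix.mul_zero _
  have hw := hg.mulVec ψ
  simp only [TTop, LLStarMat, Matrix.mulVec_add, Matrix.mulVec_sum, Matrix.sub_mulVec,
    Matrix.sum_mulVec, Matrix.mulVec_mulVec]
  rw [Jop_add (SuppBddBelow.sum _ fun i _ => (hg.Del_iterate i).mulVec _)
      (hGφ.mulVec_left _),
    Jop_sub (SuppBddBelow.sum _ fun i _ => hg.mulVec _) (hg.mulVec _),
    Jop_sum _ fun i _ => (hg.Del_iterate i).mulVec _, Jop_sum _ fun i _ => hg.mulVec _,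
    Jop_mulVec_Jop hGφ hw]
  simp only [h _ g hg, Finset.sum_add_distrib, Matrix.mulVec_mulVec]
  abel

theorem TTop_mulVec_const (b : ℕ → ℤ → Matrix (Fin r) (Fin r) R)
    (φ : ℤ → Matrix (Fin r) (Fin m) R) {ψ : ℤ → Matrix (Fin m) (Fin r) R}
    (hψ : SuppBddBelow ψ) (F : ℤ → Matrix (Fin r) (Fin p) R) (v : Fin p → R) :
    TTop n b φ ψ (fun x => (F x).mulVec v) = fun x => (LLMat n b φ ψ F x).mulVec v := by
  have hψF : SuppBddBelow fun y => ψ y * F y :=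
    hψ.map (fun y M => M * F y) fun _ => Matrix.zero_mul _
  funext x
  have hD : ∀ i, Del^[i] (fun y => (F y).mulVec v) x = (Del^[i] F x).mulVec v :=
    fun i => congrFun (Del_iterate_map (mulVecHom v) i F) x
  have hJ : Jop (fun y => (ψ y * F y).mulVec v) x = (Jop (fun y => ψ y * F y) x).mulVec v :=
    congrFun (Jop_map (mulVecHom v) hψF) x
  simp only [TTop, LLMat, hD, hJ, Matrix.mulVec_mulVec, Matrix.add_mulVec, Matrix.sum_mulVec]

theorem TTop_iterate_mulVec_const (b : ℕ → ℤ → Matrix (Fin r) (Fin r) R)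
    (φ : ℤ → Matrix (Fin r) (Fin m) R) {ψ : ℤ → Matrix (Fin m) (Fin r) R}
    (hψ : SuppBddBelow ψ) (k : ℕ) (F : ℤ → Matrix (Fin r) (Fin p) R) (v : Fin p → R) :
    (TTop n b φ ψ)^[k] (fun x => (F x).mulVec v)
      = fun x => ((LLMat n b φ ψ)^[k] F x).mulVec v := by
  induction k generalizing F with
  | zero => rfl
  | succ k ih => rw [Function.iterate_succ_apply, TTop_mulVec_const b φ hψ, ih]; rfl

/-- `𝕋ᵏ = Σ_{j<k} M_{𝕃^{k-1-j}·φ}∘J∘M_{(𝕃*)ʲ·ψ}` up to a local operator. -/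
theorem exists_TTop_iterate (b : ℕ → ℤ → Matrix (Fin r) (Fin r) R)
    {φ : ℤ → Matrix (Fin r) (Fin m) R} {ψ : ℤ → Matrix (Fin m) (Fin r) R}
    (hφ : SuppBddBelow φ) (hψ : SuppBddBelow ψ) (k : ℕ) :
    ∃ P ∈ localOps R r r, ∀ g : ℤ → Fin r → R, SuppBddBelow g → ∀ x : ℤ,
      (TTop n b φ ψ)^[k] g x
        = P g x + ∑ j ∈ Finset.range k,
            ((LLMat n b φ ψ)^[k - 1 - j] φ x).mulVec
              (Jop (fun y => ((LLStarMat n b φ ψ)^[j] ψ y).mulVec (g y)) x) := by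
  induction k with
  | zero =>
    refine ⟨_, mulVec_Del_iterate_mem_localOps (fun _ => 1) 0, fun g _ x => ?_⟩
    simp
  | succ k ih =>
    obtain ⟨P, hP, h⟩ := ih
    obtain ⟨N, c, hc⟩ := exists_sum_of_mem_localOps hP
    choose Q hQ hQ' using exists_Del_iterate_mulVec_Jop φ ψ
    choose S hS hS' using fun j =>
      exists_Jop_mulVec_TTop (n := n) b ψ hφ ((LLStarMat n b φ ψ)^[j] ψ)
    have hA : (fun (g : ℤ → Fin r → R) x =>
        ∑ i ∈ Finset.range (n + 1), (b i x).mulVec (Del^[i] g x)) ∈ localOps R r r :=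
      sum_mem_localOps _ fun i _ => mulVec_Del_iterate_mem_localOps (b i) i
    refine ⟨_, add_mem (add_mem
      (sum_mem_localOps (Finset.range (N + 1)) fun i _ =>
        mulVec_comp_mem_localOps (c i) (Del_iterate_comp_mem_localOps i hA))
      (sum_mem_localOps (Finset.range (N + 1)) fun i _ =>
        mulVec_comp_mem_localOps (c i) (hQ i)))
      (sum_mem_localOps (Finset.range k) fun j _ =>
        mulVec_comp_mem_localOps ((LLMat n b φ ψ)^[k - 1 - j] φ) (hS j)), fun g hg x => ?_⟩
    set v := Jop (fun y => (ψ y).mulVec (g y)) x with hv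
    have hφv := h _ (hφ.mulVec_left fun _ => v) x
    rw [TTop_iterate_mulVec_const b φ hψ] at hφv
    have hD : ∀ i, Del^[i] (fun y => (φ y).mulVec v) x = (Del^[i] φ x).mulVec v :=
      fun i => congrFun (Del_iterate_map (mulVecHom v) i φ) x
    have hJ : ∀ j, Jop (fun y => ((LLStarMat n b φ ψ)^[j] ψ y).mulVec ((φ y).mulVec v)) x
        = (Jop (fun y => (LLStarMat n b φ ψ)^[j] ψ y * φ y) x).mulVec v := fun j => by
      simp only [Matrix.mulVec_mulVec]
      exact congrFun (Jop_map (mulVecHom v)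
        (hφ.map (fun y M => (LLStarMat n b φ ψ)^[j] ψ y * M) fun _ => Matrix.mul_zero _)) x
    have hDT : ∀ i, Del^[i] (TTop n b φ ψ g) x
        = Del^[i] (fun y => ∑ i ∈ Finset.range (n + 1), (b i y).mulVec (Del^[i] g y)) x
          + ((Del^[i] φ x).mulVec v + Q i g x) := fun i => by
      rw [hv, ← congrFun (hQ' i g hg) x]
      exact congrFun (Del_iterate_add i _ _) x
    rw [Function.iterate_succ_apply, h _ (SuppBddBelow.TTop b ψ hφ hg), Finset.sum_range_succ']
    simp only [hc, hD, hJ] at hφv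
    simp only [hc, hDT, hS' _ g hg, ← hv, Matrix.mulVec_add, Finset.sum_add_distrib,
      Nat.add_sub_cancel, Nat.sub_zero, Function.iterate_zero, id_eq, hφv, Pi.add_apply,
      Function.iterate_succ_apply' (LLStarMat n b φ ψ), Nat.sub_sub, Nat.add_comm 1]
    abel

end LocalOps

/-- for every `k ≥ 1` there exist `N` and `c₀,…,c_N` such that, as
operators on `V_r`,
`𝕋ᵏ = Σ_{i=0}^{N} M_{c_i}∘Δⁱ + Σ_{j=0}^{k-1} M_{𝕃^{k-1-j}·φ}∘J∘M_{(𝕃*)ʲ·ψ}`. -/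
theorem stmt8 {r m n : ℕ} (b : ℕ → ℤ → Matrix (Fin r) (Fin r) R)
    (φ : ℤ → Matrix (Fin r) (Fin m) R) (ψ : ℤ → Matrix (Fin m) (Fin r) R)
    (hφ : SuppBddBelow φ) (hψ : SuppBddBelow ψ) :
    ∀ k : ℕ, 1 ≤ k →
      ∃ (N : ℕ) (c : ℕ → ℤ → Matrix (Fin r) (Fin r) R),
        ∀ g : ℤ → Fin r → R, SuppBddBelow g → ∀ x : ℤ,
          (TTop n b φ ψ)^[k] g x
            = (∑ i ∈ Finset.range (N + 1), (c i x).mulVec (Del^[i] g x))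
              + ∑ j ∈ Finset.range k,
                  ((LLMat n b φ ψ)^[k - 1 - j] φ x).mulVec
                    (Jop (fun y => ((LLStarMat n b φ ψ)^[j] ψ y).mulVec (g y)) x) := by
  intro k _
  obtain ⟨P, hP, h⟩ := exists_TTop_iterate (n := n) b hφ hψ k
  obtain ⟨N, c, hc⟩ := exists_sum_of_mem_localOps hP
  exact ⟨N, c, fun g hg x => by rw [h g hg x, hc]⟩
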